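/- Let ρ^s be the supremum of c ∈ ℝ over all tuples (c, h_2,…,h_N) with h_i ∈ ℝ[Ā_i] (polynomials supported in Ā_i) such that p_1(x)/q_1(x) + ∑_{i=2}^N h_i(x) ≥ c for all x ∈ K and p_i(x)/q_i(x) ≥ h_i(x) for all x ∈ K for each i = 2,…,N. Then ρ^s = ρ. -/

import Mathlib

open MvPolynomial

noncomputable section

/-- Parity pairing `r·α = ∑ᵢ rᵢ αᵢ` between `r ∈ {0,1}ⁿ` and an exponent vector `α`. -/
def dotPar {n : ℕ} (r : Fin n → Fin 2) (α : Fin n →₀ ℕ) : ℕ :=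
  ∑ i, (r i : ℕ) * α i

/-- Sign symmetries `R(A) = {r ∈ {0,1}ⁿ : r·α ≡ 0 (mod 2) ∀ α ∈ A}`. -/
def signSyms {n : ℕ} (A : Finset (Fin n →₀ ℕ)) : Finset (Fin n → Fin 2) :=
  Finset.univ.filter fun r => ∀ α ∈ A, 2 ∣ dotPar r α

/-- `Ā = {α ∈ ℕⁿ : r·α ≡ 0 (mod 2) ∀ r ∈ R(A)}`. -/
def symClosure {n : ℕ} (A : Finset (Fin n →₀ ℕ)) : Set (Fin n →₀ ℕ) :=
  {α | ∀ r ∈ signSyms A, 2 ∣ dotPar r α}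

/-- `A_i = supp(p_i) ∪ supp(q_i) ∪ ⋃_j supp(g_j)` (for `i = 2,…,N`). -/
def ABase {n m : ℕ} (g : Fin m → MvPolynomial (Fin n) ℝ)
    (pi qi : MvPolynomial (Fin n) ℝ) : Finset (Fin n →₀ ℕ) :=
  pi.support ∪ qi.support ∪ Finset.univ.biUnion fun j => (g j).support

/-- The family `A_1, …, A_N` of the paper; index `0 : Fin N` plays the role of `1`,
and `A_1 = supp(p_1) ∪ supp(q_1) ∪ ⋃_{i=2}^N A_i`. -/
def AFam {n m N : ℕ} [NeZero N] (g : Fin m → MvPolynomial (Fin n) ℝ)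
    (p q : Fin N → MvPolynomial (Fin n) ℝ) (i : Fin N) : Finset (Fin n →₀ ℕ) :=
  if i = 0 then
    (p 0).support ∪ (q 0).support ∪
      (Finset.univ.erase (0 : Fin N)).biUnion fun i' => ABase g (p i') (q i')
  else ABase g (p i) (q i)

/-- The action of a sign vector `r ∈ {0,1}ⁿ` on `ℝⁿ`, flipping the coordinates with `rᵢ = 1`. -/
def signFlip {n : ℕ} (r : Fin n → Fin 2) (x : Fin n → ℝ) : Fin n → ℝ :=
  fun i => (-1) ^ (r i : ℕ) * x i

lemma eval_signFlip {n : ℕ} (r : Fin n → Fin 2) (x : Fin n → ℝ) (f : MvPolynomial (Fin n) ℝ) :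
    eval (signFlip r x) f
      = ∑ α ∈ f.support, (-1) ^ dotPar r α * (coeff α f * ∏ i, x i ^ α i) := by
  rw [eval_eq']
  refine Finset.sum_congr rfl fun α _ => ?_
  simp only [signFlip, dotPar, mul_pow, Finset.prod_mul_distrib, ← pow_mul,
    Finset.prod_pow_eq_pow_sum]
  ring

lemma eval_signFlip_of_even {n : ℕ} {r : Fin n → Fin 2} {f : MvPolynomial (Fin n) ℝ}
    (hf : ∀ α ∈ f.support, 2 ∣ dotPar r α) (x : Fin n → ℝ) :
    eval (signFlip r x) f = eval x f := by
  rw [eval_signFlip, eval_eq']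
  refine Finset.sum_congr rfl fun α hα => ?_
  rw [(even_iff_two_dvd.2 (hf α hα)).neg_one_pow, one_mul]

/-- The part of `f` supported on the exponents that pair evenly with `r`. -/
def evenPart {n : ℕ} (r : Fin n → Fin 2) (f : MvPolynomial (Fin n) ℝ) :
    MvPolynomial (Fin n) ℝ :=
  ∑ α ∈ f.support with 2 ∣ dotPar r α, monomial α (coeff α f)

lemma coeff_evenPart {n : ℕ} (r : Fin n → Fin 2) (f : MvPolynomial (Fin n) ℝ) (α : Fin n →₀ ℕ) :
    coeff α (evenPart r f) = if 2 ∣ dotPar r α then coeff α f else 0 := by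
  simp only [evenPart, coeff_sum, coeff_monomial, Finset.sum_ite_eq', Finset.mem_filter,
    mem_support_iff]
  split_ifs <;> simp_all

lemma mem_support_evenPart {n : ℕ} {r : Fin n → Fin 2} {f : MvPolynomial (Fin n) ℝ}
    {α : Fin n →₀ ℕ} :
    α ∈ (evenPart r f).support ↔ α ∈ f.support ∧ 2 ∣ dotPar r α := by
  rw [mem_support_iff, mem_support_iff, coeff_evenPart]
  split_ifs <;> simp_all

lemma eval_evenPart {n : ℕ} (r : Fin n → Fin 2) (f : MvPolynomial (Fin n) ℝ) (x : Fin n → ℝ) :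
    eval x (evenPart r f) = (eval x f + eval (signFlip r x) f) / 2 := by
  rw [eval_signFlip, eval_eq' x f, ← Finset.sum_add_distrib, Finset.sum_div, evenPart, map_sum,
    Finset.sum_filter]
  refine Finset.sum_congr rfl fun α _ => ?_
  split_ifs with h
  · rw [(even_iff_two_dvd.2 h).neg_one_pow, eval_monomial, Finsupp.prod_fintype _ _ (by simp)]
    ring
  · rw [(Nat.not_even_iff_odd.1 (mt even_iff_two_dvd.1 h)).neg_one_pow]
    ring

/-- Real polynomials are uniformly dense in the continuous functions on a compact set. -/
lemma exists_mvPolynomial_near {n : ℕ} {K : Set (Fin n → ℝ)} (hK : IsCompact K)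
    {f : (Fin n → ℝ) → ℝ} (hf : ContinuousOn f K) {ε : ℝ} (hε : 0 < ε) :
    ∃ h : MvPolynomial (Fin n) ℝ, ∀ x ∈ K, |eval x h - f x| < ε := by
  have := isCompact_iff_compactSpace.1 hK
  let X : Fin n → C(K, ℝ) := fun i => ⟨fun x => x.1 i, (continuous_apply i).comp continuous_subtype_val⟩
  have hX : ∀ (h : MvPolynomial (Fin n) ℝ) (x : K), aeval X h x = eval x.1 h := by
    intro h x
    induction h using MvPolynomial.induction_on with
    | C a => simp
    | add a b ha hb => simp [ha, hb]
    | mul_X a i ha => simp [ha, X]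
  have hsep : (aeval (R := ℝ) X).range.SeparatesPoints := by
    intro x y hxy
    obtain ⟨i, hi⟩ := Function.ne_iff.1 (Subtype.coe_injective.ne hxy)
    exact ⟨X i, ⟨X i, ⟨MvPolynomial.X i, aeval_X _ _⟩, rfl⟩, hi⟩
  obtain ⟨⟨_, h, rfl⟩, hh⟩ :=
    ContinuousMap.exists_mem_subalgebra_near_continuous_of_separatesPoints _ hsep
      (K.domRestrict f) hf.domRestrict ε hε
  refine ⟨h, fun x hx => ?_⟩
  have := hh ⟨x, hx⟩
  simpa [hX, Set.domRestrict] using this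

/-- A function invariant under a set of sign flips is uniformly approximated by polynomials whose
exponents pair evenly with these flips. -/
lemma exists_even_mvPolynomial_near {n : ℕ} {K : Set (Fin n → ℝ)} (hK : IsCompact K)
    {f : (Fin n → ℝ) → ℝ} (hf : ContinuousOn f K) {ε : ℝ} (hε : 0 < ε)
    (S : Finset (Fin n → Fin 2)) (hSK : ∀ r ∈ S, ∀ x ∈ K, signFlip r x ∈ K)
    (hSf : ∀ r ∈ S, ∀ x ∈ K, f (signFlip r x) = f x) :
    ∃ h : MvPolynomial (Fin n) ℝ, (∀ α ∈ h.support, ∀ r ∈ S, 2 ∣ dotPar r α) ∧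
      ∀ x ∈ K, |eval x h - f x| < ε := by
  induction S using Finset.induction_on with
  | empty => simpa using exists_mvPolynomial_near hK hf hε
  | insert r S _ ih =>
    obtain ⟨h, hsupp, hnear⟩ := ih (fun s hs => hSK s (Finset.mem_insert_of_mem hs))
      (fun s hs => hSf s (Finset.mem_insert_of_mem hs))
    refine ⟨evenPart r h, fun α hα s hs => ?_, fun x hx => ?_⟩
    · rw [mem_support_evenPart] at hα
      rcases Finset.mem_insert.1 hs with rfl | hs
      · exact hα.2
      · exact hsupp α hα.1 s hs
    · have h₁ := abs_lt.1 (hnear x hx)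
      have h₂ := abs_lt.1 (hnear _ (hSK r (Finset.mem_insert_self r S) x hx))
      rw [hSf r (Finset.mem_insert_self r S) x hx] at h₂
      rw [eval_evenPart, abs_lt]
      constructor <;> linarith [h₁.1, h₁.2, h₂.1, h₂.2]

lemma exists_near_div_of_ABase {n m : ℕ} {g : Fin m → MvPolynomial (Fin n) ℝ}
    {p q : MvPolynomial (Fin n) ℝ} (hK : IsCompact {x | ∀ j, 0 ≤ eval x (g j)})
    (hq : ∀ x, (∀ j, 0 ≤ eval x (g j)) → 0 < eval x q) {ε : ℝ} (hε : 0 < ε) :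
    ∃ h : MvPolynomial (Fin n) ℝ, ↑h.support ⊆ symClosure (ABase g p q) ∧
      ∀ x, (∀ j, 0 ≤ eval x (g j)) →
        eval x h ≤ eval x p / eval x q ∧ eval x p / eval x q - ε ≤ eval x h := by
  have heven : ∀ r ∈ signSyms (ABase g p q), ∀ α ∈ ABase g p q, 2 ∣ dotPar r α :=
    fun r hr => (Finset.mem_filter.1 hr).2
  have hp' : ∀ r ∈ signSyms (ABase g p q), ∀ x, eval (signFlip r x) p = eval x p :=
    fun r hr => eval_signFlip_of_even fun α hα => heven r hr α (by
      simp only [ABase, Finset.mem_union]; exact .inl (.inl hα))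
  have hq' : ∀ r ∈ signSyms (ABase g p q), ∀ x, eval (signFlip r x) q = eval x q :=
    fun r hr => eval_signFlip_of_even fun α hα => heven r hr α (by
      simp only [ABase, Finset.mem_union]; exact .inl (.inr hα))
  have hg' : ∀ r ∈ signSyms (ABase g p q), ∀ j x, eval (signFlip r x) (g j) = eval x (g j) :=
    fun r hr j => eval_signFlip_of_even fun α hα => heven r hr α (by
      simp only [ABase, Finset.mem_union, Finset.mem_biUnion]
      exact .inr ⟨j, Finset.mem_univ j, hα⟩)
  obtain ⟨h, hsupp, hnear⟩ := exists_even_mvPolynomial_near hK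
    (f := fun x => eval x p / eval x q - ε / 2)
    (((continuous_eval p).continuousOn.div (continuous_eval q).continuousOn
      fun x hx => (hq x hx).ne').sub continuousOn_const) (half_pos hε)
    (signSyms (ABase g p q))
    (fun r hr x hx j => by rw [hg' r hr]; exact hx j)
    (fun r hr x _ => by simp only [hp' r hr, hq' r hr])
  refine ⟨h, hsupp, fun x hx => ?_⟩
  have := abs_lt.1 (hnear x hx)
  constructor <;> linarith [this.1, this.2]

/-- The sign symmetry adapted dual problem (SD) has value `ρ`:
`ρ^s`, the supremum of `c` over tuples `(c, h_2, …, h_N)` with `h_i ∈ ℝ[Ā_i]`,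
`p_1/q_1 + ∑_{i≥2} h_i ≥ c` on `K` and `h_i ≤ p_i/q_i` on `K`, equals
`ρ = inf_{x∈K} ∑_i p_i(x)/q_i(x)`. -/
theorem stmt_6 (n m N : ℕ) [NeZero N]
    (g : Fin m → MvPolynomial (Fin n) ℝ) (p q : Fin N → MvPolynomial (Fin n) ℝ)
    (K : Set (Fin n → ℝ)) (hKdef : K = {x | ∀ j, 0 ≤ eval x (g j)})
    (hK : IsCompact K) (hKne : K.Nonempty)
    (hq : ∀ i, ∀ x ∈ K, 0 < eval x (q i)) :
    sSup {c : ℝ | ∃ h : Fin N → MvPolynomial (Fin n) ℝ,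
        (∀ i : Fin N, i ≠ 0 → ↑(h i).support ⊆ symClosure (AFam g p q i)) ∧
        (∀ x ∈ K, c ≤ eval x (p 0) / eval x (q 0) +
          ∑ i ∈ Finset.univ.erase (0 : Fin N), eval x (h i)) ∧
        (∀ i : Fin N, i ≠ 0 → ∀ x ∈ K,
          eval x (h i) ≤ eval x (p i) / eval x (q i))} =
      sInf {v : ℝ | ∃ x ∈ K, v = ∑ i, eval x (p i) / eval x (q i)} := by
  subst hKdef
  have hsplit : ∀ F : Fin N → ℝ,
      F 0 + ∑ i ∈ Finset.univ.erase (0 : Fin N), F i = ∑ i, F i :=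
    fun F => Finset.add_sum_erase _ F (Finset.mem_univ 0)
  have hbdd : BddBelow {v : ℝ | ∃ x ∈ {x | ∀ j, 0 ≤ eval x (g j)},
      v = ∑ i, eval x (p i) / eval x (q i)} := by
    have hcont : ContinuousOn (fun x => ∑ i, eval x (p i) / eval x (q i))
        {x | ∀ j, 0 ≤ eval x (g j)} :=
      continuousOn_finsetSum _ fun i _ => (continuous_eval (p i)).continuousOn.div
        (continuous_eval (q i)).continuousOn fun x hx => (hq i x hx).ne'
    refine (hK.bddBelow_image hcont).mono ?_
    rintro _ ⟨x, hx, rfl⟩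
    exact ⟨x, hx, rfl⟩
  have hweak : ∀ c ∈ {c : ℝ | ∃ h : Fin N → MvPolynomial (Fin n) ℝ,
        (∀ i : Fin N, i ≠ 0 → ↑(h i).support ⊆ symClosure (AFam g p q i)) ∧
        (∀ x ∈ {x | ∀ j, 0 ≤ eval x (g j)}, c ≤ eval x (p 0) / eval x (q 0) +
          ∑ i ∈ Finset.univ.erase (0 : Fin N), eval x (h i)) ∧
        (∀ i : Fin N, i ≠ 0 → ∀ x ∈ {x | ∀ j, 0 ≤ eval x (g j)},
          eval x (h i) ≤ eval x (p i) / eval x (q i))},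
      c ≤ sInf {v : ℝ | ∃ x ∈ {x | ∀ j, 0 ≤ eval x (g j)},
        v = ∑ i, eval x (p i) / eval x (q i)} := by
    rintro c ⟨h, -, hc, hle⟩
    obtain ⟨x₀, hx₀⟩ := hKne
    refine le_csInf ⟨_, x₀, hx₀, rfl⟩ ?_
    rintro _ ⟨x, hx, rfl⟩
    rw [← hsplit fun i => eval x (p i) / eval x (q i)]
    exact (hc x hx).trans (add_le_add le_rfl (Finset.sum_le_sum fun i hi =>
      hle i (Finset.ne_of_mem_erase hi) x hx))
  have hstrong : ∀ ε > 0, sInf {v : ℝ | ∃ x ∈ {x | ∀ j, 0 ≤ eval x (g j)},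
      v = ∑ i, eval x (p i) / eval x (q i)} - ε ∈
      {c : ℝ | ∃ h : Fin N → MvPolynomial (Fin n) ℝ,
        (∀ i : Fin N, i ≠ 0 → ↑(h i).support ⊆ symClosure (AFam g p q i)) ∧
        (∀ x ∈ {x | ∀ j, 0 ≤ eval x (g j)}, c ≤ eval x (p 0) / eval x (q 0) +
          ∑ i ∈ Finset.univ.erase (0 : Fin N), eval x (h i)) ∧
        (∀ i : Fin N, i ≠ 0 → ∀ x ∈ {x | ∀ j, 0 ≤ eval x (g j)},
          eval x (h i) ≤ eval x (p i) / eval x (q i))} := by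
    intro ε hε
    have hN : (0 : ℝ) < N := Nat.cast_pos.2 (NeZero.pos N)
    choose h hsupp hnear using fun i =>
      exists_near_div_of_ABase (p := p i) hK (hq i) (div_pos hε hN)
    refine ⟨h, fun i hi => ?_, fun x hx => ?_, fun i _ x hx => (hnear i x hx).1⟩
    · rw [AFam, if_neg hi]
      exact hsupp i
    · have hinf := csInf_le hbdd ⟨x, hx, rfl⟩
      rw [← hsplit fun i => eval x (p i) / eval x (q i)] at hinf
      have hgap : ∑ i ∈ Finset.univ.erase (0 : Fin N),
          (eval x (p i) / eval x (q i) - eval x (h i)) ≤ ε := calc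
        _ ≤ ∑ i : Fin N, (eval x (p i) / eval x (q i) - eval x (h i)) :=
          Finset.sum_le_sum_of_subset_of_nonneg (Finset.erase_subset _ _)
            fun i _ _ => sub_nonneg.2 (hnear i x hx).1
        _ ≤ ∑ _i : Fin N, ε / N :=
          Finset.sum_le_sum fun i _ => by linarith [(hnear i x hx).2]
        _ = ε := by
          rw [Finset.sum_const, Finset.card_univ, Fintype.card_fin, nsmul_eq_mul]
          field_simp
      rw [Finset.sum_sub_distrib] at hgap
      linarith
  refine le_antisymm (csSup_le ⟨_, hstrong 1 one_pos⟩ hweak) ?_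
  refine le_of_forall_pos_sub_le fun ε hε => ?_
  exact le_csSup ⟨_, hweak⟩ (hstrong ε hε)
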